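/- Let F be an n×n complex positive semidefinite matrix and let v ∈ ℂ^n be such that v v^H − F is positive semidefinite. Then there exists a real number c with 0 ≤ c ≤ 1 such that F = c · (v v^H). -/

import Mathlib

open ComplexOrder

theorem psd_aux_ker (n : ℕ) (F : Matrix (Fin n) (Fin n) ℂ)
    (v : Fin n → ℂ) (hF : F.PosSemidef)
    (hdom : (Matrix.vecMulVec v (star v) - F).PosSemidef) (x : Fin n → ℂ)
    (hx : star v ⬝ᵥ x = 0) : F.mulVec x = 0 := by
  have h1 := hF.dotProduct_mulVec_nonneg x
  have h2 := hdom.dotProduct_mulVec_nonneg x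
  rw [Matrix.sub_mulVec, Matrix.vecMulVec_mulVec, hx] at h2
  simp only [MulOpposite.op_zero, zero_smul, zero_sub, dotProduct_neg] at h2
  exact (hF.dotProduct_mulVec_zero_iff x).1 (le_antisymm (neg_nonneg.1 h2) h1)

/-- A PSD matrix dominated (in the Loewner order) by the rank-one PSD matrix
`v v^H` is itself `c · v v^H` for some `c ∈ [0,1]`. -/
theorem psd_dominated_by_rank_one (n : ℕ) (F : Matrix (Fin n) (Fin n) ℂ)
    (v : Fin n → ℂ) (hF : F.PosSemidef)
    (hdom : (Matrix.vecMulVec v (star v) - F).PosSemidef) :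
    ∃ c : ℝ, 0 ≤ c ∧ c ≤ 1 ∧ F = (c : ℂ) • Matrix.vecMulVec v (star v) := by
  have ker := psd_aux_ker n F v hF hdom
  by_cases hv : v = 0
  · refine ⟨0, le_rfl, zero_le_one, ?_⟩
    subst hv
    ext k j
    have := congrFun (ker (Pi.single j 1) (by simp)) k
    simpa using this
  · obtain ⟨i, hi⟩ := Function.ne_iff.1 hv
    have hi : v i ≠ 0 := hi
    have key : ∀ k j, star (v i) * F k j = star (v j) * F k i := by
      intro k j
      have := congrFun (ker (star (v i) • Pi.single j 1 - star (v j) • Pi.single i 1)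
        (by simp [dotProduct_sub, mul_comm])) k
      simp only [Matrix.mulVec_sub, Matrix.mulVec_smul] at this
      simpa [sub_eq_zero] using this
    have key2 : ∀ k, v i * F k i = v k * F i i := by
      intro k
      have := congrArg star (key i k)
      simp only [star_mul', star_star, hF.1.apply] at this
      exact this
    have d1 : 0 ≤ F i i := hF.diag_nonneg
    have d2 : 0 ≤ (Matrix.vecMulVec v (star v) - F) i i := hdom.diag_nonneg
    have e : v i * star (v i) = (Complex.normSq (v i) : ℂ) := Complex.mul_conj _
    have hpos : 0 < Complex.normSq (v i) := Complex.normSq_pos.2 hi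
    have hre : F i i = ((F i i).re : ℂ) := Complex.eq_re_of_ofReal_le d1
    have r1 : 0 ≤ (F i i).re := (Complex.le_def.1 d1).1
    have r2 : (F i i).re ≤ Complex.normSq (v i) := by
      rw [Matrix.sub_apply, Matrix.vecMulVec_apply, Pi.star_apply, e] at d2
      simpa using (Complex.le_def.1 d2).1
    refine ⟨(F i i).re / Complex.normSq (v i), by positivity, (div_le_one hpos).2 r2, ?_⟩
    ext k j
    have hne : v i * star (v i) ≠ 0 := mul_ne_zero hi (star_ne_zero.2 hi)
    rw [Matrix.smul_apply, Matrix.vecMulVec_apply, Pi.star_apply, Complex.ofReal_div, ← hre, ← e,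
      smul_eq_mul, div_mul_eq_mul_div, eq_div_iff hne]
    linear_combination v i * key k j + star (v j) * key2 k
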